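/- arXiv:2409.05194 — 4 statements merged into one kernel-verified Lean document; each statement's English description precedes it below -/
import Mathlib

section
/- Suppose μ is non-atomic. Then every nonempty open subset of L⁰(μ), in the topology of convergence in probability, is unbounded in the canonical bornology of L⁰(μ). -/
open MeasureTheory Filter Topology Pointwise

noncomputable section

namespace EquicontKothe

variable {Ω : Type*} [MeasurableSpace Ω] (μ : Measure Ω) [IsProbabilityMeasure μ]

/-- Convergence in probability of a sequence in `L⁰(μ)`. -/
def TendstoInProb (f : ℕ → Ω →ₘ[μ] ℝ) (g : Ω →ₘ[μ] ℝ) : Prop :=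
  TendstoInMeasure μ (fun n => ⇑(f n)) atTop ⇑g

/-- A set of elements of `L⁰(μ)` is closed in probability (stated sequentially, which is
equivalent since the topology of convergence in probability is metrizable). -/
def ClosedInProb (C : Set (Ω →ₘ[μ] ℝ)) : Prop :=
  ∀ f : ℕ → Ω →ₘ[μ] ℝ, (∀ n, f n ∈ C) → ∀ g : Ω →ₘ[μ] ℝ, TendstoInProb μ f g → g ∈ C

/-- Boundedness in probability. -/
def BoundedInProb (C : Set (Ω →ₘ[μ] ℝ)) : Prop :=
  ∀ ε : ℝ, 0 < ε → ∃ δ : ℝ, 0 < δ ∧ ∀ f ∈ C, μ {ω | δ ≤ |f ω|} ≤ ENNReal.ofReal ε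

/-- The polar of a set `C ⊆ L⁰(μ)`. -/
def polar (C : Set (Ω →ₘ[μ] ℝ)) : Set (Ω →ₘ[μ] ℝ) :=
  {g | ∀ f ∈ C, ∫⁻ ω, (‖f ω * g ω‖₊ : ENNReal) ∂μ ≤ 1}

/-- `E_K`, the span of `K`. -/
def EK (K : Set (Ω →ₘ[μ] ℝ)) : Submodule ℝ (Ω →ₘ[μ] ℝ) := Submodule.span ℝ K

/-- `E'_K`, the span of the polar of `K`. -/
def EK' (K : Set (Ω →ₘ[μ] ℝ)) : Submodule ℝ (Ω →ₘ[μ] ℝ) := Submodule.span ℝ (polar μ K)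

/-- The pairing `(f, g) ↦ ∫ fg dμ`. -/
def pair (f g : Ω →ₘ[μ] ℝ) : ℝ := ∫ ω, f ω * g ω ∂μ

/-- A set `F ⊆ L⁰(μ)` is solid. -/
def SolidSet (F : Set (Ω →ₘ[μ] ℝ)) : Prop :=
  ∀ g ∈ F, ∀ h : Ω →ₘ[μ] ℝ, (∀ᵐ ω ∂μ, |h ω| ≤ |g ω|) → h ∈ F

/-- A set `F ⊆ L⁰(μ)` is a linear subspace. -/
def IsSubspace (F : Set (Ω →ₘ[μ] ℝ)) : Prop :=
  (0 : Ω →ₘ[μ] ℝ) ∈ F ∧ (∀ g ∈ F, ∀ h ∈ F, g + h ∈ F) ∧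
    ∀ (a : ℝ) (g : Ω →ₘ[μ] ℝ), g ∈ F → a • g ∈ F

/-- `g` is strictly positive, i.e. `g > 0` a.e. -/
def StrictlyPos (g : Ω →ₘ[μ] ℝ) : Prop := ∀ᵐ ω ∂μ, 0 < g ω

/-- `F` separates the points of the subspace `E` via the pairing `(f,g) ↦ ∫ fg dμ`. -/
def Separates (F : Set (Ω →ₘ[μ] ℝ)) (E : Submodule ℝ (Ω →ₘ[μ] ℝ)) : Prop :=
  ∀ f ∈ E, f ≠ 0 → ∃ g ∈ F, pair μ f g ≠ 0

/-- The weak topology `σ(E, F)` on a subspace `E ⊆ L⁰(μ)` induced by the pairing with `F`. -/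
def weakTop (E : Submodule ℝ (Ω →ₘ[μ] ℝ)) (F : Set (Ω →ₘ[μ] ℝ)) : TopologicalSpace E :=
  ⨅ g ∈ F, TopologicalSpace.induced (fun f : E => pair μ (f : Ω →ₘ[μ] ℝ) g) inferInstance

/-- A set `A ⊆ E_K` is `K`-bounded if it is contained in some positive multiple of `K`. -/
def KBdd (K : Set (Ω →ₘ[μ] ℝ)) (A : Set (EK μ K)) : Prop :=
  ∃ c : ℝ, 0 < c ∧ ∀ f ∈ A, ((f : Ω →ₘ[μ] ℝ)) ∈ c • K

/-- `τ` is an equicontinuous Köthe topology on `E_K` induced by `F`. -/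
def IsEquicontKothe (K : Set (Ω →ₘ[μ] ℝ)) (τ : TopologicalSpace (EK μ K))
    (F : Set (Ω →ₘ[μ] ℝ)) : Prop :=
  @IsCompact _ τ {f : EK μ K | (f : Ω →ₘ[μ] ℝ) ∈ K} ∧
  F ⊆ (EK' μ K : Set (Ω →ₘ[μ] ℝ)) ∧
  IsSubspace μ F ∧
  SolidSet μ F ∧
  (∃ g ∈ F, StrictlyPos μ g) ∧
  Separates μ F (EK μ K) ∧
  ∀ A : Set (EK μ K), KBdd μ K A →
    TopologicalSpace.induced (Subtype.val : A → EK μ K) τ =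
      TopologicalSpace.induced (Subtype.val : A → EK μ K) (weakTop μ (EK μ K) F)

/-- `τ` has the Krein-Šmulian property. -/
def KreinSmulian (K : Set (Ω →ₘ[μ] ℝ)) (τ : TopologicalSpace (EK μ K)) : Prop :=
  ∀ C : Set (EK μ K), Convex ℝ C →
    (@IsClosed _ τ C ↔ ∀ c : ℝ, 0 < c → @IsClosed _ τ (C ∩ {f | (f : Ω →ₘ[μ] ℝ) ∈ c • K}))

/-- Convexity for extended-real-valued functions. -/
def ConvexFn {E : Type*} [AddCommMonoid E] [Module ℝ E] (φ : E → EReal) : Prop :=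
  ∀ f g : E, ∀ a b : ℝ, 0 ≤ a → 0 ≤ b → a + b = 1 →
    φ (a • f + b • g) ≤ (a : EReal) * φ f + (b : EReal) * φ g

/-- Properness: `φ` takes values in `(-∞, ∞]` and is not identically `∞`. -/
def ProperFn {E : Type*} (φ : E → EReal) : Prop :=
  (∀ f, φ f ≠ ⊥) ∧ ∃ f, φ f ≠ ⊤

/-- The equicontinuous Fatou property. -/
def EquicontFatou (K : Set (Ω →ₘ[μ] ℝ)) (φ : EK μ K → EReal) : Prop :=
  ∀ (f : ℕ → EK μ K) (g : EK μ K),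
    (∃ c : ℝ, 0 < c ∧ ∀ n, ((f n : Ω →ₘ[μ] ℝ)) ∈ c • K) →
    TendstoInProb μ (fun n => ((f n : Ω →ₘ[μ] ℝ))) (g : Ω →ₘ[μ] ℝ) →
    φ g ≤ liminf (fun n => φ (f n)) atTop

/-- `τ` is `F`-regular: every `τ`-continuous linear functional is represented by some `g ∈ F`. -/
def FRegular (K : Set (Ω →ₘ[μ] ℝ)) (τ : TopologicalSpace (EK μ K))
    (F : Set (Ω →ₘ[μ] ℝ)) : Prop :=
  ∀ T : EK μ K →ₗ[ℝ] ℝ, @Continuous _ _ τ _ T →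
    ∃ g ∈ F, ∀ f : EK μ K, T f = pair μ (f : Ω →ₘ[μ] ℝ) g

/-- The conjugate `φ*` of `φ` at `g`. -/
def phiStar (K : Set (Ω →ₘ[μ] ℝ)) (φ : EK μ K → EReal) (g : Ω →ₘ[μ] ℝ) : EReal :=
  ⨆ h : EK μ K, ((pair μ (h : Ω →ₘ[μ] ℝ) g : ℝ) : EReal) - φ h

/-- The solid hull of `K`. -/
def solidHull (K : Set (Ω →ₘ[μ] ℝ)) : Set (Ω →ₘ[μ] ℝ) :=
  {f | ∃ g ∈ K, ∀ᵐ ω ∂μ, |f ω| ≤ |g ω|}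

/-- `S` is uniformly `ν`-integrable. -/
def UnifInt (ν : Measure Ω) (S : Set (Ω →ₘ[μ] ℝ)) : Prop :=
  (∀ ε : ℝ, 0 < ε → ∃ δ : ℝ, 0 < δ ∧ ∀ A : Set Ω, MeasurableSet A →
      ν A < ENNReal.ofReal δ →
      ∀ f ∈ S, ∫⁻ ω in A, (‖f ω‖₊ : ENNReal) ∂ν < ENNReal.ofReal ε) ∧
  ∃ C : ℝ, ∀ f ∈ S, ∫⁻ ω, (‖f ω‖₊ : ENNReal) ∂ν ≤ ENNReal.ofReal C

/-- `μ` is non-atomic. -/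
def Nonatomic : Prop :=
  ∀ A : Set Ω, MeasurableSet A → 0 < μ A →
    ∃ B : Set Ω, MeasurableSet B ∧ B ⊆ A ∧ 0 < μ B ∧ μ B < μ A

/-- Increasing with respect to the μ-a.e. order. -/
def MonoInc {E : Submodule ℝ (Ω →ₘ[μ] ℝ)} (φ : E → EReal) : Prop :=
  ∀ f h : E, (∀ᵐ ω ∂μ, (f : Ω →ₘ[μ] ℝ) ω ≤ (h : Ω →ₘ[μ] ℝ) ω) → φ f ≤ φ h

/-- Decreasing with respect to the μ-a.e. order. -/
def MonoDec {E : Submodule ℝ (Ω →ₘ[μ] ℝ)} (φ : E → EReal) : Prop :=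
  ∀ f h : E, (∀ᵐ ω ∂μ, (f : Ω →ₘ[μ] ℝ) ω ≤ (h : Ω →ₘ[μ] ℝ) ω) → φ h ≤ φ f

/-- The `F`-positive Hahn-Banach property of `E_K`. -/
def PosHB (K : Set (Ω →ₘ[μ] ℝ)) (F : Set (Ω →ₘ[μ] ℝ)) : Prop :=
  ∀ T : EK μ K →ₗ[ℝ] ℝ,
    @Continuous _ _ (weakTop μ (EK μ K) F) _ T →
    (∀ f : EK μ K, (∀ᵐ ω ∂μ, 0 ≤ (f : Ω →ₘ[μ] ℝ) ω) → 0 ≤ T f) →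
    ∃ S : EK μ (solidHull μ K) →ₗ[ℝ] ℝ,
      @Continuous _ _ (weakTop μ (EK μ (solidHull μ K)) F) _ S ∧
      (∀ f : EK μ (solidHull μ K), (∀ᵐ ω ∂μ, 0 ≤ (f : Ω →ₘ[μ] ℝ) ω) → 0 ≤ S f) ∧
      ∀ (f : Ω →ₘ[μ] ℝ) (hf : f ∈ EK μ K) (hf' : f ∈ EK μ (solidHull μ K)),
        S ⟨f, hf'⟩ = T ⟨f, hf⟩


section Theorems

variable (K : Set (Ω →ₘ[μ] ℝ))

/-- Openness in the topology of convergence in probability, expressed through the Ky Fan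
metric `d(f, g) = ∫ min(|f - g|, 1) dμ`. -/
def OpenInProb (C : Set (Ω →ₘ[μ] ℝ)) : Prop :=
  ∀ f ∈ C, ∃ r : ℝ, 0 < r ∧
    ∀ g : Ω →ₘ[μ] ℝ, (∫ ω, min |f ω - g ω| 1 ∂μ) < r → g ∈ C

/-- A non-atomic probability measure has measurable sets of measure in `(0, 2⁻ⁿ]`. -/
lemma Nonatomic.exists_measure_le_inv_two_pow {μ : Measure Ω} [IsProbabilityMeasure μ]
    (hna : Nonatomic μ) (n : ℕ) :
    ∃ A : Set Ω, MeasurableSet A ∧ 0 < μ.real A ∧ μ.real A ≤ (1 / 2 : ℝ) ^ n := by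
  induction n with
  | zero => exact ⟨Set.univ, MeasurableSet.univ, by simp, by simp⟩
  | succ n ih =>
    obtain ⟨A, hA, hpos, hle⟩ := ih
    obtain ⟨B, hB, hBA, hB0, hlt⟩ := hna A hA (ENNReal.toReal_pos_iff.mp hpos).1
    have hB0' : 0 < μ.real B := ENNReal.toReal_pos hB0.ne' (measure_ne_top μ B)
    have hlt' : μ.real B < μ.real A :=
      (ENNReal.toReal_lt_toReal (measure_ne_top μ B) (measure_ne_top μ A)).mpr hlt
    have hdiff : μ.real (A \ B) = μ.real A - μ.real B := measureReal_sdiff hBA hB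
    rcases le_total (μ.real B) (μ.real A / 2) with h | h
    · exact ⟨B, hB, hB0', by rw [pow_succ]; linarith⟩
    · exact ⟨A \ B, hA.diff hB, by linarith, by rw [pow_succ]; linarith⟩

/-- Changing `f` on `A` moves it by at most `μ A` in the Ky Fan metric. -/
lemma integral_min_abs_sub_le_of_ae_eq_compl {μ : Measure Ω} [IsProbabilityMeasure μ]
    {f g : Ω → ℝ} {A : Set Ω} (hA : MeasurableSet A) (h : ∀ᵐ ω ∂μ, ω ∉ A → g ω = f ω) :
    ∫ ω, min |f ω - g ω| 1 ∂μ ≤ μ.real A := by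
  rw [← integral_indicator_one hA]
  refine integral_mono_of_nonneg (.of_forall fun ω => by positivity)
    ((integrable_const 1).indicator hA) ?_
  filter_upwards [h] with ω hω
  by_cases hωA : ω ∈ A
  · simp [hωA]
  · simp [hωA, hω hωA]

theorem stmt11 (hna : Nonatomic μ) (C : Set (Ω →ₘ[μ] ℝ))
    (hC : OpenInProb μ C) (hne : C.Nonempty) : ¬ BoundedInProb μ C := by
  intro hbdd
  obtain ⟨f, hf⟩ := hne
  obtain ⟨r, hr, hball⟩ := hC f hf
  obtain ⟨n, hn⟩ := exists_pow_lt_of_lt_one hr (by norm_num : (1 / 2 : ℝ) < 1)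
  obtain ⟨A, hA, hpos, hle⟩ := hna.exists_measure_le_inv_two_pow n
  obtain ⟨δ, -, hδ⟩ := hbdd (μ.real A / 2) (half_pos hpos)
  classical
  have hmeas : AEStronglyMeasurable (A.piecewise (fun _ => δ) f) μ :=
    (Measurable.piecewise hA measurable_const f.measurable).aestronglyMeasurable
  set g : Ω →ₘ[μ] ℝ := AEEqFun.mk _ hmeas
  have hg : g =ᵐ[μ] A.piecewise (fun _ => δ) f := AEEqFun.coeFn_mk _ hmeas
  have hgC : g ∈ C := by
    refine hball g (lt_of_le_of_lt (integral_min_abs_sub_le_of_ae_eq_compl hA ?_) (hle.trans_lt hn))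
    filter_upwards [hg] with ω hω hωA
    rw [hω, Set.piecewise_eq_of_notMem _ _ _ hωA]
  have hsub : μ A ≤ μ {ω | δ ≤ |g ω|} := by
    refine measure_mono_ae ?_
    filter_upwards [hg] with ω hω hωA
    change δ ≤ |g ω|
    rw [hω, Set.piecewise_eq_of_mem _ _ _ hωA]
    exact le_abs_self δ
  have hhalf := ENNReal.toReal_le_of_le_ofReal (half_pos hpos).le (hsub.trans (hδ g hgC))
  change μ.real A ≤ μ.real A / 2 at hhalf
  linarith

end Theorems

end EquicontKothe
end
end

section
/- Suppose μ is non-atomic. Then there is no probability measure ν on (Ω, 𝓕) equivalent to μ such that the closed unit ball of L¹(μ) is uniformly ν-integrable; consequently, taking K to be the closed unit ball of L¹(μ), the space E_K = L¹(μ) admits no equicontinuous Köthe topology. -/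
open MeasureTheory Filter Topology Pointwise

noncomputable section

namespace EquicontKothe

variable {Ω : Type*} [MeasurableSpace Ω] (μ : Measure Ω) [IsProbabilityMeasure μ]

section Theorems

variable (K : Set (Ω →ₘ[μ] ℝ))

/-- The closed unit ball of `L¹(μ)`, viewed inside `L⁰(μ)`. -/
def L1ball : Set (Ω →ₘ[μ] ℝ) := {f | Integrable (⇑f) μ ∧ ∫ ω, |f ω| ∂μ ≤ 1}

/-- The class in `L⁰(μ)` of the function equal to `r` on `B` and to `0` elsewhere. -/
def indClass (B : Set Ω) (hB : MeasurableSet B) (r : ℝ) : Ω →ₘ[μ] ℝ :=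
  AEEqFun.mk (B.indicator fun _ => r) (aestronglyMeasurable_const.indicator hB)

lemma coeFn_indClass (B : Set Ω) (hB : MeasurableSet B) (r : ℝ) :
    indClass μ B hB r =ᵐ[μ] B.indicator fun _ => r :=
  AEEqFun.coeFn_mk _ _

lemma indClass_mem_L1ball (B : Set Ω) (hB : MeasurableSet B) :
    indClass μ B hB (μ.real B)⁻¹ ∈ L1ball μ := by
  have h := coeFn_indClass μ B hB (μ.real B)⁻¹
  refine ⟨((integrable_const _).indicator hB).congr h.symm, ?_⟩
  have h' : (fun ω => |indClass μ B hB (μ.real B)⁻¹ ω|)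
      =ᵐ[μ] B.indicator fun _ => (μ.real B)⁻¹ := by
    filter_upwards [h] with ω hω
    rw [hω, abs_of_nonneg]
    exact Set.indicator_nonneg (fun _ _ => inv_nonneg.2 measureReal_nonneg) ω
  rw [integral_congr_ae h', integral_indicator_const _ hB, smul_eq_mul]
  exact mul_inv_le_one

/-- The pairing of an element of `L⁰(μ)` with an indicator is an integral over the set. -/
lemma pair_indClass_one (f : Ω →ₘ[μ] ℝ) (A : Set Ω) (hA : MeasurableSet A) :
    pair μ f (indClass μ A hA 1) = ∫ ω in A, f ω ∂μ := by
  rw [pair, ← integral_indicator hA]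
  refine integral_congr_ae ?_
  filter_upwards [coeFn_indClass μ A hA 1] with ω hω
  by_cases h : ω ∈ A <;> simp [hω, h]

lemma setIntegral_indClass (B A : Set Ω) (hB : MeasurableSet B) (r : ℝ) :
    ∫ ω in A, indClass μ B hB r ω ∂μ = μ.real (A ∩ B) * r := by
  rw [integral_congr_ae (ae_restrict_of_ae (coeFn_indClass μ B hB r)),
    setIntegral_indicator hB, setIntegral_const, smul_eq_mul]

variable {μ} in
/-- In a non-atomic space every set of positive measure contains one of at most half, still
positive, measure. -/
lemma Nonatomic.exists_half (hna : Nonatomic μ) {A : Set Ω} (hA : MeasurableSet A)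
    (hpos : 0 < μ A) :
    ∃ B : Set Ω, MeasurableSet B ∧ B ⊆ A ∧ 0 < μ B ∧ μ B ≤ μ A / 2 := by
  obtain ⟨B, hB, hBA, hB0, hlt⟩ := hna A hA hpos
  have hadd : μ B + μ (A \ B) = μ A := by
    rw [← measure_inter_add_sdiff A hB, Set.inter_eq_right.2 hBA]
  by_cases h : μ B ≤ μ A / 2
  · exact ⟨B, hB, hBA, hB0, h⟩
  · refine ⟨A \ B, hA.diff hB, Set.sdiff_subset, ?_, ?_⟩
    · rw [pos_iff_ne_zero]
      intro h0
      rw [h0, add_zero] at hadd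
      exact hlt.ne hadd
    · by_contra h'
      have := ENNReal.add_lt_add (not_le.1 h) (not_le.1 h')
      rw [ENNReal.add_halves, hadd] at this
      exact this.false

variable {μ} in
/-- In a non-atomic space every set of positive measure contains a decreasing sequence of sets
of positive measure tending to zero. -/
lemma Nonatomic.exists_antitone (hna : Nonatomic μ) {A : Set Ω} (hA : MeasurableSet A)
    (hpos : 0 < μ A) :
    ∃ B : ℕ → Set Ω, (∀ n, MeasurableSet (B n)) ∧ (∀ n, B n ⊆ A) ∧ Antitone B ∧
      (∀ n, 0 < μ (B n)) ∧ Tendsto (fun n => μ (B n)) atTop (𝓝 0) := by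
  let T := {S : Set Ω // MeasurableSet S ∧ S ⊆ A ∧ 0 < μ S}
  have hstep : ∀ S : T, ∃ S' : T, S'.1 ⊆ S.1 ∧ μ S'.1 ≤ μ S.1 / 2 := fun S => by
    obtain ⟨B, hB, hBS, hB0, hle⟩ := hna.exists_half S.2.1 S.2.2.2
    exact ⟨⟨B, hB, hBS.trans S.2.2.1, hB0⟩, hBS, hle⟩
  choose next hsub hhalf using hstep
  let B : ℕ → T := fun n => next^[n] ⟨A, hA, subset_rfl, hpos⟩
  have hsucc : ∀ n, B (n + 1) = next (B n) := fun n => Function.iterate_succ_apply' _ _ _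
  have hbound : ∀ n, μ (B n).1 ≤ 2⁻¹ ^ n := by
    intro n
    induction n with
    | zero => simpa using prob_le_one
    | succ n ih =>
      rw [hsucc, pow_succ, ← div_eq_mul_inv]
      exact (hhalf _).trans (ENNReal.div_le_div_right ih 2)
  refine ⟨fun n => (B n).1, fun n => (B n).2.1, fun n => (B n).2.2.1,
    antitone_nat_of_succ_le fun n => ?_, fun n => (B n).2.2.2, ?_⟩
  · rw [hsucc]; exact hsub _
  · exact tendsto_of_tendsto_of_tendsto_of_le_of_le tendsto_const_nhds
      (ENNReal.tendsto_pow_atTop_nhds_zero_of_lt_one (by norm_num)) (fun _ => zero_le) hbound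

variable {μ} in
/-- The closed unit ball of `L¹(μ)` is not uniformly `ν`-integrable for `ν ≪ μ`. -/
lemma Nonatomic.not_unifInt_L1ball (hna : Nonatomic μ) (ν : Measure Ω) [IsProbabilityMeasure ν]
    (hνμ : ν ≪ μ) : ¬ UnifInt μ ν (L1ball μ) := by
  rintro ⟨hui, -⟩
  have hden : ∀ s, MeasurableSet s → ∫⁻ ω in s, ν.rnDeriv μ ω ∂μ = ν s :=
    fun s _ => Measure.setLIntegral_rnDeriv hνμ s
  have hint : ∫⁻ ω, ν.rnDeriv μ ω ∂μ = 1 := by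
    rw [Measure.lintegral_rnDeriv hνμ, measure_univ]
  have hmeas : MeasurableSet {ω | 1 ≤ ν.rnDeriv μ ω} :=
    measurableSet_le measurable_const (Measure.measurable_rnDeriv ν μ)
  have hpos : 0 < μ {ω | 1 ≤ ν.rnDeriv μ ω} := by
    have := measure_lintegral_le_pos (μ := μ) (f := ν.rnDeriv μ) (by simp [hint])
    rwa [hint] at this
  obtain ⟨B, hB, hBA, -, hB0, hlim⟩ := hna.exists_antitone hmeas hpos
  have hνlim : Tendsto (fun n => ν (B n)) atTop (𝓝 0) := by
    have := tendsto_setLIntegral_zero (μ := μ) (f := ν.rnDeriv μ) (by simp [hint]) hlim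
    simpa only [hden _ (hB _)] using this
  have hle : ∀ n, μ (B n) ≤ ν (B n) := fun n => by
    rw [← hden _ (hB n), ← setLIntegral_one]
    exact setLIntegral_mono' (hB n) fun ω hω => hBA n hω
  obtain ⟨δ, hδ, hui⟩ := hui 1 one_pos
  obtain ⟨n, hn⟩ := (hνlim.eventually (gt_mem_nhds (ENNReal.ofReal_pos.2 hδ))).exists
  refine (hui (B n) (hB n) hn _ (indClass_mem_L1ball μ (B n) (hB n))).not_ge ?_
  have heq : ∫⁻ ω in B n, (‖indClass μ (B n) (hB n) (μ.real (B n))⁻¹ ω‖₊ : ENNReal) ∂ν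
      = ∫⁻ _ in B n, (μ (B n))⁻¹ ∂ν := by
    refine setLIntegral_congr_fun_ae (hB n) ?_
    filter_upwards [hνμ.ae_le (coeFn_indClass μ (B n) (hB n) (μ.real (B n))⁻¹)] with ω hω hωB
    rw [hω, Set.indicator_of_mem hωB, ← enorm_eq_nnnorm,
      Real.enorm_of_nonneg (inv_nonneg.2 measureReal_nonneg), ENNReal.ofReal_inv_of_pos
      (show 0 < μ.real (B n) from ENNReal.toReal_pos (hB0 n).ne' (measure_ne_top _ _)), ofReal_measureReal]
  rw [heq, setLIntegral_const, ENNReal.ofReal_one,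
    ← ENNReal.inv_mul_cancel (hB0 n).ne' (measure_ne_top μ (B n))]
  exact mul_le_mul_right (hle n) _

/-- A sequence in a compact space has a point `a` such that every continuous real function that is
eventually constant along the sequence takes that value at `a`. -/
lemma exists_eq_of_eventually_eq {X : Type*} [TopologicalSpace X] [CompactSpace X] (u : ℕ → X) :
    ∃ a : X, ∀ φ : X → ℝ, Continuous φ → ∀ c : ℝ, (∀ᶠ n in atTop, φ (u n) = c) → φ a = c := by
  obtain ⟨a, ha⟩ := exists_clusterPt_of_compactSpace (map u atTop)
  refine ⟨a, fun φ hφ c hc => ?_⟩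
  have hcl : IsClosed {x | φ x = c} := isClosed_eq hφ continuous_const
  exact hcl.closure_subset (mem_closure_iff_clusterPt.2 (ha.mono (le_principal_iff.2 hc)))

variable {μ} in
/-- A solid subspace with a strictly positive element contains all indicators of the measurable
subsets of some set of positive measure. -/
lemma exists_indClass_mem {F : Set (Ω →ₘ[μ] ℝ)} (hF : IsSubspace μ F) (hsolid : SolidSet μ F)
    {g : Ω →ₘ[μ] ℝ} (hgF : g ∈ F) (hg : StrictlyPos μ g) :
    ∃ A : Set Ω, MeasurableSet A ∧ 0 < μ A ∧
      ∀ (S : Set Ω) (hS : MeasurableSet S), S ⊆ A → indClass μ S hS 1 ∈ F := by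
  obtain ⟨n, hn⟩ : ∃ n : ℕ, 0 < μ {ω | 1 ≤ (n : ℝ) * g ω} := by
    refine exists_measure_pos_of_not_measure_iUnion_null fun h0 => ?_
    have : ∀ᵐ _ ∂μ, False := by
      filter_upwards [hg, measure_eq_zero_iff_ae_notMem.1 h0] with ω hω hω'
      obtain ⟨n, hn⟩ := Archimedean.arch 1 hω
      exact hω' (Set.mem_iUnion.2 ⟨n, by simpa using hn⟩)
    exact NeZero.ne μ (by simpa using this)
  have hmeas : MeasurableSet {ω | 1 ≤ (n : ℝ) * g ω} :=
    measurableSet_le measurable_const (g.measurable.const_mul _)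
  refine ⟨_, hmeas, hn, fun S hS hSA => hsolid _ (hF.2.2 n g hgF) _ ?_⟩
  filter_upwards [coeFn_indClass μ S hS 1, AEEqFun.coeFn_smul (n : ℝ) g] with ω h1 h2
  rw [h1, h2]
  by_cases h : ω ∈ S
  · simpa [h] using (show (1 : ℝ) ≤ n * g ω from hSA h).trans (le_abs_self _)
  · rw [Set.indicator_of_notMem h, abs_zero]
    exact abs_nonneg _

variable {μ} in
/-- The space `L¹(μ)` over a non-atomic space carries no equicontinuous Köthe topology. -/
lemma Nonatomic.not_isEquicontKothe_L1ball (hna : Nonatomic μ)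
    (τ : TopologicalSpace (EK μ (L1ball μ))) (F : Set (Ω →ₘ[μ] ℝ)) :
    ¬ IsEquicontKothe μ (L1ball μ) τ F := by
  rintro ⟨hK, -, hF, hsolid, ⟨g, hgF, hg⟩, -, htop⟩
  obtain ⟨A, hA, hA0, hAF⟩ := exists_indClass_mem hF hsolid hgF hg
  obtain ⟨B, hB, hBA, hanti, hB0, hlim⟩ := hna.exists_antitone hA hA0
  let X : Set (EK μ (L1ball μ)) := {f | (f : Ω →ₘ[μ] ℝ) ∈ L1ball μ}
  have htopX := htop X ⟨1, one_pos, fun f hf => by rwa [one_smul]⟩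
  have hX : @CompactSpace X (TopologicalSpace.induced Subtype.val τ) :=
    @isCompact_iff_compactSpace _ τ X |>.1 hK
  rw [htopX] at hX
  let _ : TopologicalSpace X :=
    TopologicalSpace.induced Subtype.val (weakTop μ (EK μ (L1ball μ)) F)
  have hcont : ∀ k ∈ F, Continuous fun x : X => pair μ (x.1 : Ω →ₘ[μ] ℝ) k := fun k hk => by
    let _ : TopologicalSpace (EK μ (L1ball μ)) := weakTop μ (EK μ (L1ball μ)) F
    have h : Continuous fun f : EK μ (L1ball μ) => pair μ (f : Ω →ₘ[μ] ℝ) k :=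
      continuous_iff_le_induced.2 (iInf₂_le k hk)
    exact h.comp continuous_induced_dom
  let u : ℕ → X := fun n => ⟨⟨indClass μ (B n) (hB n) (μ.real (B n))⁻¹,
    Submodule.subset_span (indClass_mem_L1ball μ _ (hB n))⟩, indClass_mem_L1ball μ _ (hB n)⟩
  obtain ⟨a, ha⟩ := exists_eq_of_eventually_eq u
  set f : Ω →ₘ[μ] ℝ := (a.1 : Ω →ₘ[μ] ℝ)
  have hf : Integrable f μ := a.2.1
  have hone : ∫ ω in A, f ω ∂μ = 1 := by
    rw [← pair_indClass_one μ f A hA]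
    refine ha _ (hcont _ (hAF A hA subset_rfl)) 1 (Eventually.of_forall fun n => ?_)
    simp only [u]
    rw [pair_indClass_one, setIntegral_indClass, Set.inter_eq_right.2 (hBA n)]
    exact mul_inv_cancel₀ (ENNReal.toReal_pos (hB0 n).ne' (measure_ne_top _ _)).ne'
  have hzero : ∀ m, ∫ ω in A \ B m, f ω ∂μ = 0 := fun m => by
    rw [← pair_indClass_one μ f _ (hA.diff (hB m))]
    refine ha _ (hcont _ (hAF _ (hA.diff (hB m)) Set.sdiff_subset)) 0 ?_
    filter_upwards [eventually_ge_atTop m] with n hn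
    simp only [u]
    rw [pair_indClass_one, setIntegral_indClass]
    have : A \ B m ∩ B n = ∅ :=
      (Set.disjoint_sdiff_left.mono_right (hanti hn)).inter_eq
    simp [this]
  have hBone : ∀ m, ∫ ω in B m, f ω ∂μ = 1 := fun m => by
    have := setIntegral_sdiff (hB m) hf.integrableOn (hBA m)
    rw [hzero, hone] at this
    linarith
  have h0 : Tendsto (fun m => ∫ ω in B m, f ω ∂μ) atTop (𝓝 0) :=
    hf.tendsto_setIntegral_nhds_zero hlim
  simp only [hBone] at h0
  exact one_ne_zero (tendsto_nhds_unique tendsto_const_nhds h0)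

theorem stmt12 (hna : Nonatomic μ) :
    (∀ ν : Measure Ω, IsProbabilityMeasure ν → ν ≪ μ → μ ≪ ν →
        ¬ UnifInt μ ν (L1ball μ)) ∧
    ∀ (τ : TopologicalSpace (EK μ (L1ball μ))) (F : Set (Ω →ₘ[μ] ℝ)),
      ¬ IsEquicontKothe μ (L1ball μ) τ F := by
  exact ⟨fun ν _ hνμ _ => hna.not_unifInt_L1ball ν hνμ, hna.not_isEquicontKothe_L1ball⟩

end Theorems

end EquicontKothe
end
end

section
/- Let ⟨E, F⟩ be a dual pair of real vector spaces. If x' is a σ(E, F)-continuous linear functional on E, then there exists f ∈ F such that x'(x) = ⟨x, f⟩ for all x ∈ E. -/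
open Filter Topology

/-- **Representation of weakly continuous functionals.** Let `⟨E, F⟩` be a dual pair of real
vector spaces, given by a bilinear form `B` separating points in each variable. If `x'` is a
linear functional on `E` that is continuous with respect to the weak topology `σ(E, F)` (the
initial topology of the maps `x ↦ B x f`, `f ∈ F`), then there exists `f ∈ F` such that
`x' x = ⟨x, f⟩` for all `x ∈ E`. -/
theorem stmt15 {E F : Type*} [AddCommGroup E] [Module ℝ E] [AddCommGroup F] [Module ℝ F]
    (B : E →ₗ[ℝ] F →ₗ[ℝ] ℝ)
    (hsepE : ∀ x : E, x ≠ 0 → ∃ f : F, B x f ≠ 0)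
    (hsepF : ∀ f : F, f ≠ 0 → ∃ x : E, B x f ≠ 0)
    (x' : E →ₗ[ℝ] ℝ)
    (hx' : @Continuous _ _
      (⨅ f : F, TopologicalSpace.induced (fun x : E => B x f) inferInstance) _ x') :
    ∃ f : F, ∀ x : E, x' x = B x f := by
  have h : x' ∈ Submodule.span ℝ (Set.range B.flip) :=
    (LinearMap.mem_span_iff_continuous (f := B.flip) x').2 hx'
  rw [← LinearMap.coe_range, Submodule.span_eq] at h
  obtain ⟨f, rfl⟩ := h
  exact ⟨f, fun _ => rfl⟩
end

section
/- Let F ⊆ E'_K be a solid subspace containing a strictly positive element (an element ξ with ξ > 0 μ-a.e.). Then F separates the points of E_K via the pairing (f, g) ↦ ∫_Ω fg dμ: for every f ∈ E_K with f ≠ 0 there exists g ∈ F with fg ∈ L¹(μ) and ∫_Ω fg dμ ≠ 0. -/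
open MeasureTheory Filter Topology Pointwise

noncomputable section

namespace EquicontKothe

variable {Ω : Type*} [MeasurableSpace Ω] (μ : Measure Ω) [IsProbabilityMeasure μ]

section Theorems

variable (K : Set (Ω →ₘ[μ] ℝ))

theorem integrable_mul_of_mem_EK {f g : Ω →ₘ[μ] ℝ} (hf : f ∈ EK μ K) (hg : g ∈ EK' μ K) :
    Integrable (fun ω => f ω * g ω) μ := by
  induction hg using Submodule.span_induction with
  | mem g hg =>
    induction hf using Submodule.span_induction with
    | mem f hf =>
      exact ⟨f.aestronglyMeasurable.mul g.aestronglyMeasurable,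
        (hg f hf).trans_lt ENNReal.one_lt_top⟩
    | zero =>
      refine (integrable_zero Ω ℝ μ).congr ?_
      filter_upwards [AEEqFun.coeFn_zero (α := Ω) (β := ℝ) (μ := μ)] with ω h
      simp [h]
    | add x y _ _ hx hy =>
      refine (hx.add hy).congr ?_
      filter_upwards [AEEqFun.coeFn_add x y] with ω h
      simp [h, add_mul]
    | smul a x _ hx =>
      refine (hx.const_mul a).congr ?_
      filter_upwards [AEEqFun.coeFn_smul a x] with ω h
      simp [h, mul_assoc]
  | zero =>
    refine (integrable_zero Ω ℝ μ).congr ?_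
    filter_upwards [AEEqFun.coeFn_zero (α := Ω) (β := ℝ) (μ := μ)] with ω h
    simp [h]
  | add x y _ _ hx hy =>
    refine (hx.add hy).congr ?_
    filter_upwards [AEEqFun.coeFn_add x y] with ω h
    simp [h, mul_add]
  | smul a x _ hx =>
    refine (hx.const_mul a).congr ?_
    filter_upwards [AEEqFun.coeFn_smul a x] with ω h
    simp [h, mul_left_comm]

theorem exists_abs_eq_and_mul_eq_abs_mul (f ξ : Ω →ₘ[μ] ℝ) :
    ∃ g : Ω →ₘ[μ] ℝ, (∀ᵐ ω ∂μ, |g ω| = |ξ ω|) ∧ ∀ᵐ ω ∂μ, f ω * g ω = |f ω| * ξ ω := by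
  have hm : AEStronglyMeasurable (fun ω => if 0 ≤ f ω then ξ ω else -ξ ω) μ :=
    (Measurable.ite (measurableSet_le measurable_const f.measurable) ξ.measurable
      ξ.measurable.neg).aestronglyMeasurable
  refine ⟨AEEqFun.mk _ hm, ?_, ?_⟩
  · filter_upwards [AEEqFun.coeFn_mk _ hm] with ω h
    rw [h]
    split_ifs <;> simp
  · filter_upwards [AEEqFun.coeFn_mk _ hm] with ω h
    rw [h]
    split_ifs with h0
    · rw [abs_of_nonneg h0]
    · rw [abs_of_neg (not_le.mp h0), mul_neg, neg_mul]

theorem stmt16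
    (hconv : Convex ℝ K) (hbal : Balanced ℝ K)
    (hcl : ClosedInProb μ K) (hbdd : BoundedInProb μ K)
    (F : Set (Ω →ₘ[μ] ℝ)) (hFsub : F ⊆ (EK' μ K : Set (Ω →ₘ[μ] ℝ)))
    (hFss : IsSubspace μ F) (hFsolid : SolidSet μ F)
    (hpos : ∃ ξ ∈ F, StrictlyPos μ ξ) :
    ∀ f : Ω →ₘ[μ] ℝ, f ∈ EK μ K → f ≠ 0 →
      ∃ g ∈ F, Integrable (fun ω => f ω * g ω) μ ∧ ∫ ω, f ω * g ω ∂μ ≠ 0 := by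
  intro f hf hf0
  obtain ⟨ξ, hξ, hξpos⟩ := hpos
  obtain ⟨g, hgabs, hfg⟩ := exists_abs_eq_and_mul_eq_abs_mul μ f ξ
  have hgF : g ∈ F := hFsolid ξ hξ g (hgabs.mono fun _ h => h.le)
  have hint := integrable_mul_of_mem_EK μ K hf (hFsub hgF)
  refine ⟨g, hgF, hint, fun h0 => hf0 ?_⟩
  have hnonneg : 0 ≤ᵐ[μ] fun ω => f ω * g ω := by
    filter_upwards [hfg, hξpos] with ω h hp
    rw [h]
    exact mul_nonneg (abs_nonneg _) hp.le
  have hzero := (integral_eq_zero_iff_of_nonneg_ae hnonneg hint).mp h0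
  refine AEEqFun.ext ?_
  filter_upwards [hzero, hfg, hξpos, AEEqFun.coeFn_zero (α := Ω) (β := ℝ) (μ := μ)]
    with ω hz h hp h0
  rw [h0]
  rw [h] at hz
  simpa [hp.ne'] using hz

end Theorems

end EquicontKothe
end
end
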